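/- arXiv:2003.01844 — 2 statements merged into one kernel-verified Lean document; each statement's English description precedes it below -/
import Mathlib

section
/- Lemma: Let M ∈ ARI(Γ) be bialternal, let m ≥ 3, and let σ_1,…,σ_m ∈ Γ with σ_1σ_2⋯σ_m = 1. Then the following three identities hold: (cyclic symmetry) ũ(M)^m(x_1,…,x_m ; σ_1,…,σ_m) = ũ(M)^m(x_2,…,x_m,x_1 ; σ_2,…,σ_m,σ_1); (inversion) ũ(M)^m(x_1,…,x_m ; σ_1,…,σ_m) = ũ(M)^m(−x_1,…,−x_m ; σ_1^{−1},…,σ_m^{−1}); (reflection) ũ(M)^m(x_1,…,x_{m−1},x_m ; σ_1,…,σ_{m−1},σ_m) = (−1)^m · ũ(M)^m(−x_{m−1},…,−x_1,−x_m ; σ_{m−1}^{−1},…,σ_1^{−1},σ_m^{−1}). -/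
namespace KVMould

/-- A mould over `Γ` in evaluation form: the depth-`m` component
`M m σ x` is the value of the rational function `M^m_{σ₁,…,σₘ}` at the
rational point `x = (x₁,…,xₘ)` (indices are 0-based). -/
abbrev Mould (Γ : Type) : Type := (m : ℕ) → (Fin m → Γ) → (Fin m → ℚ) → ℚ

variable {Γ : Type} [CommGroup Γ]

/-- `M ∈ ARI(Γ)`: the depth `0` component vanishes. -/
def IsARI (M : Mould Γ) : Prop := ∀ σ x, M 0 σ x = 0

/-- Extension of a tuple of rationals by `0` outside the range. -/
def extQ {m : ℕ} (x : Fin m → ℚ) : ℕ → ℚ := fun i => if h : i < m then x ⟨i, h⟩ else 0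

/-- Extension of a tuple of group elements by `1` outside the range. -/
def extG {m : ℕ} (σ : Fin m → Γ) : ℕ → Γ := fun i => if h : i < m then σ ⟨i, h⟩ else 1

/-- The (noncommutative, nonunital on `ARI`) mould product `A × B`. -/
def mouldMul (A B : Mould Γ) : Mould Γ := fun m σ x =>
  ∑ k ∈ Finset.range (m + 1),
    A k (fun j => extG σ j.val) (fun j => extQ x j.val) *
      B (m - k) (fun j => extG σ (k + j.val)) (fun j => extQ x (k + j.val))

/-- Ecalle's derivation `arit_u(B)(A)` (0-indexed form of the paper's
Definition of `arit_u`; the blocks `k ≤ l` below are 0-based). -/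
def aritU (B A : Mould Γ) : Mould Γ := fun m σ x =>
  (∑ k ∈ Finset.range m, ∑ l ∈ Finset.range m,
    if k ≤ l ∧ l + 1 < m then
      A (m - (l - k + 1))
        (fun j => if j.val < k then extG σ j.val
          else if j.val = k then extG σ (l + 1)
          else extG σ (j.val + (l - k + 1)))
        (fun j => if j.val < k then extQ x j.val
          else if j.val = k then ∑ i ∈ Finset.Icc k (l + 1), extQ x i
          else extQ x (j.val + (l - k + 1))) *
      B (l - k + 1)
        (fun j => extG σ (k + j.val) * (extG σ (l + 1))⁻¹)
        (fun j => extQ x (k + j.val))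
    else 0)
  -
  (∑ k ∈ Finset.range m, ∑ l ∈ Finset.range m,
    if 1 ≤ k ∧ k ≤ l then
      A (m - (l - k + 1))
        (fun j => if j.val < k - 1 then extG σ j.val
          else if j.val = k - 1 then extG σ (k - 1)
          else extG σ (j.val + (l - k + 1)))
        (fun j => if j.val < k - 1 then extQ x j.val
          else if j.val = k - 1 then ∑ i ∈ Finset.Icc (k - 1) l, extQ x i
          else extQ x (j.val + (l - k + 1))) *
      B (l - k + 1)
        (fun j => extG σ (k + j.val) * (extG σ (k - 1))⁻¹)
        (fun j => extQ x (k + j.val))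
    else 0)

/-- The `ari_u`-bracket: `ari_u(A,B) = arit_u(B)(A) − arit_u(A)(B) + A×B − B×A`. -/
def ariU (A B : Mould Γ) : Mould Γ :=
  aritU B A - aritU A B + mouldMul A B - mouldMul B A

/-- `preari_u(A,B) = arit_u(B)(A) + A×B`. -/
def preariU (A B : Mould Γ) : Mould Γ := aritU B A + mouldMul A B

/-- The set of shuffle permutations `Sh(p,q)`. -/
def shuffles (p q : ℕ) : Finset (Equiv.Perm (Fin (p + q))) :=
  Finset.univ.filter fun τ =>
    (∀ i j : Fin (p + q), i.val < j.val → j.val < p → τ⁻¹ i < τ⁻¹ j) ∧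
    (∀ i j : Fin (p + q), i.val < j.val → p ≤ i.val → τ⁻¹ i < τ⁻¹ j)

/-- Alternality of a mould. -/
def IsAlternal (M : Mould Γ) : Prop :=
  ∀ p q : ℕ, 1 ≤ p → 1 ≤ q → ∀ (σ : Fin (p + q) → Γ) (x : Fin (p + q) → ℚ),
    ∑ τ ∈ shuffles p q, M (p + q) (fun i => σ (τ i)) (fun i => x (τ i)) = 0

/-- The `swap` of a mould. -/
def swapM (M : Mould Γ) : Mould Γ := fun m σ v =>
  M m (fun i => ∏ j ∈ Finset.range (m - i.val), extG σ j)
    (fun i => extQ v (m - 1 - i.val) - extQ v (m - i.val))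

/-- Bialternality: `M` and `swap(M)` are alternal and the depth `1`
component is even (`M¹(x₁;σ₁) = M¹(−x₁;σ₁⁻¹)`). -/
def IsBialternal (M : Mould Γ) : Prop :=
  IsAlternal M ∧ IsAlternal (swapM M) ∧
    ∀ (σ : Γ) (t : ℚ), M 1 (fun _ => σ) (fun _ => t) = M 1 (fun _ => σ⁻¹) (fun _ => -t)

/-- The `push` operator. -/
def pushM (M : Mould Γ) : Mould Γ := fun m σ x =>
  M m
    (fun i => if i.val = 0 then (extG σ (m - 1))⁻¹
      else extG σ (i.val - 1) * (extG σ (m - 1))⁻¹)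
    (fun i => if i.val = 0 then -(∑ j ∈ Finset.range m, extQ x j)
      else extQ x (i.val - 1))

/-- The `v`-variant `arit_v(B)(A)`. -/
def aritV (B A : Mould Γ) : Mould Γ := fun m σ v =>
  (∑ k ∈ Finset.range m, ∑ l ∈ Finset.range m,
    if k ≤ l ∧ l + 1 < m then
      A (m - (l - k + 1))
        (fun j => if j.val < k then extG σ j.val
          else if j.val = k then ∏ i ∈ Finset.Icc k (l + 1), extG σ i
          else extG σ (j.val + (l - k + 1)))
        (fun j => if j.val < k then extQ v j.val
          else if j.val = k then extQ v (l + 1)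
          else extQ v (j.val + (l - k + 1))) *
      B (l - k + 1)
        (fun j => extG σ (k + j.val))
        (fun j => extQ v (k + j.val) - extQ v (l + 1))
    else 0)
  -
  (∑ k ∈ Finset.range m, ∑ l ∈ Finset.range m,
    if 1 ≤ k ∧ k ≤ l then
      A (m - (l - k + 1))
        (fun j => if j.val < k - 1 then extG σ j.val
          else if j.val = k - 1 then ∏ i ∈ Finset.Icc (k - 1) l, extG σ i
          else extG σ (j.val + (l - k + 1)))
        (fun j => if j.val < k - 1 then extQ v j.val
          else if j.val = k - 1 then extQ v (k - 1)
          else extQ v (j.val + (l - k + 1))) *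
      B (l - k + 1)
        (fun j => extG σ (k + j.val))
        (fun j => extQ v (k + j.val) - extQ v (k - 1))
    else 0)

/-- The `ari_v`-bracket. -/
def ariV (A B : Mould Γ) : Mould Γ :=
  aritV B A - aritV A B + mouldMul A B - mouldMul B A

/-- Pus-neutrality: all cyclic shifts of every component sum to zero. -/
def IsPusNeutral (N : Mould Γ) : Prop :=
  ∀ m : ℕ, 1 ≤ m → ∀ (σ : Fin m → Γ) (v : Fin m → ℚ),
    ∑ i ∈ Finset.range m,
      N m (fun j => extG σ ((i + j.val) % m)) (fun j => extQ v ((i + j.val) % m)) = 0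

/-- The subgroup `Γ^N = {g^N : g ∈ Γ}`. -/
def powSubgroup (Γ : Type) [CommGroup Γ] (N : ℕ) : Subgroup Γ :=
  MonoidHom.range (powMonoidHom N)

/-- The map `i_N : ARI(Γ) → ARI(Γ^N)` (restriction of indices). -/
def iN (N : ℕ) (M : Mould Γ) : Mould (powSubgroup Γ N) := fun m σ x =>
  M m (fun i => (σ i : Γ)) x

/-- The map `m_N : ARI(Γ) → ARI(Γ^N)`. -/
def mN [Fintype Γ] [DecidableEq Γ] (N : ℕ) (M : Mould Γ) :
    Mould (powSubgroup Γ N) := fun m σ x =>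
  ∑ τ ∈ Finset.univ.filter (fun τ : Fin m → Γ => ∀ i, τ i ^ N = (σ i : Γ)),
    M m τ (fun i => (N : ℚ) * x i)

/-- `M` satisfies the distribution relations. -/
def IsARID [Fintype Γ] [DecidableEq Γ] (M : Mould Γ) : Prop :=
  ∀ N : ℕ, 1 ≤ N → N ∣ Fintype.card Γ → iN N M = mN N M

/-- The parallel translation map `t`. -/
def tMap (P : Mould Γ) : Mould Γ := fun m σ v =>
  if m ≤ 1 then P m σ v
  else P (m - 1) (fun j => extG σ (j.val + 1)) (fun j => extQ v (j.val + 1) - extQ v 0)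

/-- `ũ := t ∘ swap`. -/
def uTilde (M : Mould Γ) : Mould Γ := tMap (swapM M)

section Alternal

/-- Permutations whose inverse is decreasing up to `j` and increasing from `j` on. -/
def valleyPerms {n : ℕ} (j : Fin n) : Finset (Equiv.Perm (Fin n)) :=
  Finset.univ.filter fun w =>
    (∀ a b : Fin n, a < b → b ≤ j → w⁻¹ b < w⁻¹ a) ∧
    (∀ a b : Fin n, a < b → j ≤ a → w⁻¹ a < w⁻¹ b)

/-- Permutations whose inverse is decreasing on `[0, p)` and increasing on `[p, n)`. -/
def reverseShuffles (n p : ℕ) : Finset (Equiv.Perm (Fin n)) :=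
  Finset.univ.filter fun w =>
    (∀ a b : Fin n, a < b → b.val < p → w⁻¹ b < w⁻¹ a) ∧
    (∀ a b : Fin n, a < b → p ≤ a.val → w⁻¹ a < w⁻¹ b)

/-- The involution of `Fin n` reversing the first `p` elements. -/
def reversePrefix {n p : ℕ} (hp : p ≤ n) : Equiv.Perm (Fin n) :=
  Function.Involutive.toPerm
    (fun i => ⟨if i.val < p then p - 1 - i.val else i.val, by split_ifs <;> omega⟩)
    (fun i => by ext; dsimp only; split_ifs <;> omega)

theorem reversePrefix_val {n p : ℕ} (hp : p ≤ n) (i : Fin n) :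
    (reversePrefix hp i).val = if i.val < p then p - 1 - i.val else i.val := rfl

theorem reversePrefix_mul_self {n p : ℕ} (hp : p ≤ n) :
    reversePrefix hp * reversePrefix hp = 1 := by
  ext i
  simp only [Equiv.Perm.coe_mul, Function.comp_apply, reversePrefix_val, Equiv.Perm.coe_one, id_eq]
  split_ifs <;> omega

theorem reversePrefix_inv {n p : ℕ} (hp : p ≤ n) :
    (reversePrefix hp)⁻¹ = reversePrefix hp :=
  inv_eq_of_mul_eq_one_right (reversePrefix_mul_self hp)

theorem reversePrefix_mul_mem_reverseShuffles {p q : ℕ} {τ : Equiv.Perm (Fin (p + q))}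
    (hτ : τ ∈ shuffles p q) :
    reversePrefix (Nat.le_add_right p q) * τ ∈ reverseShuffles (p + q) p := by
  simp only [shuffles, reverseShuffles, Finset.mem_filter, Finset.mem_univ, true_and, mul_inv_rev,
    reversePrefix_inv, Equiv.Perm.coe_mul, Function.comp_apply] at hτ ⊢
  refine ⟨fun a b hab hb => hτ.1 _ _ ?_ ?_, fun a b hab ha => hτ.2 _ _ ?_ ?_⟩ <;>
    simp only [reversePrefix_val] <;> split_ifs <;> omega

theorem reversePrefix_mul_mem_shuffles {p q : ℕ} {w : Equiv.Perm (Fin (p + q))}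
    (hw : w ∈ reverseShuffles (p + q) p) :
    reversePrefix (Nat.le_add_right p q) * w ∈ shuffles p q := by
  simp only [shuffles, reverseShuffles, Finset.mem_filter, Finset.mem_univ, true_and, mul_inv_rev,
    reversePrefix_inv, Equiv.Perm.coe_mul, Function.comp_apply] at hw ⊢
  refine ⟨fun a b hab hb => hw.1 _ _ ?_ ?_, fun a b hab ha => hw.2 _ _ ?_ ?_⟩ <;>
    simp only [Fin.lt_def, reversePrefix_val] <;> split_ifs <;> omega

theorem IsAlternal.sum_reverseShuffles {A : Type} {N : Mould A} (hN : IsAlternal N) {n p : ℕ}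
    (hp : 1 ≤ p) (hpn : p < n) (s : Fin n → A) (y : Fin n → ℚ) :
    ∑ w ∈ reverseShuffles n p, N n (fun i => s (w i)) (fun i => y (w i)) = 0 := by
  obtain ⟨q, rfl⟩ := Nat.exists_eq_add_of_le hpn.le
  set r := reversePrefix (Nat.le_add_right p q)
  rw [← hN p q hp (by omega) (fun i => s (r i)) (fun i => y (r i))]
  have hr : ∀ w, r * (r * w) = w := fun w => by
    rw [← mul_assoc, reversePrefix_mul_self, one_mul]
  refine Finset.sum_nbij' (r * ·) (r * ·) (fun w hw => reversePrefix_mul_mem_shuffles hw)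
    (fun τ hτ => reversePrefix_mul_mem_reverseShuffles hτ) (fun w _ => hr w) (fun w _ => hr w)
    (fun w _ => ?_)
  have h : ∀ i, r ((r * w) i) = w i := fun i => DFunLike.congr_fun (hr w) i
  simp only [h]

theorem reverseShuffles_eq_union {n : ℕ} (j : ℕ) (hj : j + 1 < n) :
    reverseShuffles n (j + 1) =
      valleyPerms (⟨j, Nat.lt_of_succ_lt hj⟩ : Fin n) ∪ valleyPerms (⟨j + 1, hj⟩ : Fin n) := by
  ext w
  simp only [reverseShuffles, valleyPerms, Finset.mem_union, Finset.mem_filter, Finset.mem_univ,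
    true_and, Fin.le_def]
  constructor
  · rintro ⟨h₁, h₂⟩
    have hne : w⁻¹ (⟨j, Nat.lt_of_succ_lt hj⟩ : Fin n) ≠ w⁻¹ ⟨j + 1, hj⟩ := by
      simp [Fin.ext_iff]
    rcases lt_or_gt_of_ne hne with h | h
    · refine Or.inl ⟨fun a b hab hb => h₁ a b hab (by omega), fun a b hab ha => ?_⟩
      rcases eq_or_lt_of_le ha with ha | ha
      · obtain rfl : (⟨j, Nat.lt_of_succ_lt hj⟩ : Fin n) = a := Fin.ext ha
        rcases eq_or_lt_of_le (show j + 1 ≤ b.val from hab) with hb | hb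
        · obtain rfl : b = ⟨j + 1, hj⟩ := Fin.ext hb.symm
          exact h
        · exact h.trans (h₂ _ b hb le_rfl)
      · exact h₂ a b hab ha
    · refine Or.inr ⟨fun a b hab hb => ?_, fun a b hab ha => h₂ a b hab ha⟩
      rcases eq_or_lt_of_le hb with hb | hb
      · obtain rfl : b = ⟨j + 1, hj⟩ := Fin.ext hb
        rcases eq_or_lt_of_le (show a.val ≤ j from Nat.lt_succ_iff.1 hab) with ha | ha
        · obtain rfl : (⟨j, Nat.lt_of_succ_lt hj⟩ : Fin n) = a := Fin.ext ha.symm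
          exact h
        · exact h.trans (h₁ a _ ha (by simp))
      · exact h₁ a b hab hb
  · rintro (⟨h₁, h₂⟩ | ⟨h₁, h₂⟩)
    · exact ⟨fun a b hab hb => h₁ a b hab (by omega),
        fun a b hab ha => h₂ a b hab (by omega)⟩
    · exact ⟨fun a b hab hb => h₁ a b hab (by omega),
        fun a b hab ha => h₂ a b hab (by omega)⟩

theorem disjoint_valleyPerms {n : ℕ} (j : ℕ) (hj : j + 1 < n) :
    Disjoint (valleyPerms (⟨j, Nat.lt_of_succ_lt hj⟩ : Fin n))
      (valleyPerms (⟨j + 1, hj⟩ : Fin n)) := by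
  rw [Finset.disjoint_left]
  intro w h₁ h₂
  simp only [valleyPerms, Finset.mem_filter, Finset.mem_univ, true_and] at h₁ h₂
  have hlt : (⟨j, Nat.lt_of_succ_lt hj⟩ : Fin n) < ⟨j + 1, hj⟩ := by simp [Fin.lt_def]
  exact lt_asymm (h₁.2 _ _ hlt le_rfl) (h₂.1 _ _ hlt le_rfl)

theorem IsAlternal.sum_valleyPerms {A : Type} {N : Mould A} (hN : IsAlternal N) {n : ℕ}
    (s : Fin n → A) (y : Fin n → ℚ) (hn : 0 < n) (j : ℕ) (hj : j < n) :
    ∑ w ∈ valleyPerms (⟨0, hn⟩ : Fin n), N n (fun i => s (w i)) (fun i => y (w i)) =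
      (-1) ^ j * ∑ w ∈ valleyPerms (⟨j, hj⟩ : Fin n),
        N n (fun i => s (w i)) (fun i => y (w i)) := by
  induction j with
  | zero => simp
  | succ j ih =>
    have h := hN.sum_reverseShuffles (Nat.succ_pos j) hj s y
    rw [reverseShuffles_eq_union j hj, Finset.sum_union (disjoint_valleyPerms j hj)] at h
    rw [ih (by omega), eq_neg_of_add_eq_zero_left h]
    ring

theorem perm_eq_one_of_strictMono {n : ℕ} {w : Equiv.Perm (Fin n)} (hw : StrictMono w) :
    w = 1 := by
  have := Subsingleton.elim (hw.orderIsoOfSurjective w w.surjective) (OrderIso.refl _)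
  ext i
  exact congrArg Fin.val (DFunLike.congr_fun this i)

theorem valleyPerms_zero (n : ℕ) : valleyPerms (0 : Fin (n + 1)) = {1} := by
  ext w
  simp only [valleyPerms, Finset.mem_filter, Finset.mem_univ, true_and, Finset.mem_singleton]
  constructor
  · rintro ⟨-, h⟩
    exact inv_eq_one.1 (perm_eq_one_of_strictMono fun a b hab => h a b hab (Fin.zero_le a))
  · rintro rfl
    refine ⟨fun a b hab hb => ?_, fun a b hab _ => by simpa using hab⟩
    simp only [Fin.le_def, Fin.lt_def, Fin.val_zero] at hab hb
    omega

theorem valleyPerms_last (n : ℕ) : valleyPerms (Fin.last n) = {Fin.revPerm} := by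
  ext w
  simp only [valleyPerms, Finset.mem_filter, Finset.mem_univ, true_and, Finset.mem_singleton]
  constructor
  · rintro ⟨h, -⟩
    have h' : Fin.revPerm * w⁻¹ = 1 := perm_eq_one_of_strictMono fun a b hab => by
      simpa using h a b hab (Fin.le_last b)
    exact (mul_inv_eq_one.1 h').symm
  · rintro rfl
    refine ⟨fun a b hab _ => ?_, fun a b hab ha => ?_⟩
    · simpa [Equiv.Perm.inv_def] using hab
    · exact absurd (ha.trans_lt hab) (Fin.le_last b).not_gt

/-- Alternal moulds are invariant, up to sign, under reversal of the word. -/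
theorem IsAlternal.eq_reverse {A : Type} {N : Mould A} (hN : IsAlternal N) (n : ℕ)
    (s : Fin (n + 1) → A) (y : Fin (n + 1) → ℚ) :
    N (n + 1) s y = (-1) ^ n * N (n + 1) (fun i => s i.rev) (fun i => y i.rev) := by
  have h := hN.sum_valleyPerms s y n.succ_pos n n.lt_succ_self
  have h₀ : valleyPerms (⟨0, n.succ_pos⟩ : Fin (n + 1)) = {1} := valleyPerms_zero n
  have h₁ : valleyPerms (⟨n, n.lt_succ_self⟩ : Fin (n + 1)) = {Fin.revPerm} := valleyPerms_last n
  rw [h₀, h₁] at h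
  simpa using h

theorem sum_shuffles_one {n : ℕ} (f : Equiv.Perm (Fin (n + 1)) → ℚ) :
    ∑ τ ∈ Finset.univ.filter (fun τ : Equiv.Perm (Fin (n + 1)) =>
      ∀ i j : Fin (n + 1), i < j → 1 ≤ i.val → τ⁻¹ i < τ⁻¹ j), f τ =
      ∑ k : Fin (n + 1), f k.cycleRange := by
  symm
  refine Finset.sum_nbij' Fin.cycleRange (fun τ => τ⁻¹ 0) (fun k _ => ?_) (fun _ _ => by simp)
    (fun k _ => ?_) (fun τ hτ => ?_) (fun _ _ => rfl)
  · simp only [Finset.mem_filter, Finset.mem_univ, true_and]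
    intro i j hij hi
    obtain ⟨i, rfl⟩ := Fin.exists_succ_eq.2 (show i ≠ 0 by rintro rfl; simp at hi)
    obtain ⟨j, rfl⟩ := Fin.exists_succ_eq.2 (Fin.ne_zero_of_lt hij)
    simpa [Equiv.Perm.inv_def, Fin.cycleRange_symm_succ] using hij
  · simp [Equiv.Perm.inv_def, Fin.cycleRange_symm_zero]
  · simp only [Finset.mem_filter, Finset.mem_univ, true_and] at hτ
    have hmono : StrictMono fun j : Fin n => τ⁻¹ j.succ := fun i j hij =>
      hτ _ _ (Fin.succ_lt_succ_iff.2 hij) (by simp)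
    have hrange : Set.range (fun j : Fin n => τ⁻¹ j.succ) =
        Set.range (Fin.succAbove (τ⁻¹ 0)) := by
      rw [Fin.range_succAbove]
      ext a
      constructor
      · rintro ⟨j, rfl⟩
        simp
      · intro ha
        obtain ⟨j, hj⟩ := Fin.exists_succ_eq.2 (show τ a ≠ 0 by
          rintro h
          exact ha (by simp [← h]))
        exact ⟨j, by simp [hj]⟩
    have key := (hmono.range_inj (Fin.strictMono_succAbove _)).1 hrange
    rw [← inv_inj]
    ext a
    refine congrArg Fin.val ?_
    refine Fin.cases ?_ (fun j => ?_) a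
    · simp [Equiv.Perm.inv_def, Fin.cycleRange_symm_zero]
    · rw [Equiv.Perm.inv_def, Fin.cycleRange_symm_succ]
      exact (congrFun key j).symm

/-- Alternality for the shuffles of the single letter `(a, z)` with a word. -/
theorem IsAlternal.sum_insertNth {A : Type} {N : Mould A} (hN : IsAlternal N) {n : ℕ} (hn : 1 ≤ n)
    (a : A) (z : ℚ) (s : Fin n → A) (y : Fin n → ℚ) :
    ∑ k : Fin (n + 1), N (n + 1) (k.insertNth a s) (k.insertNth z y) = 0 := by
  have key : ∀ p, p = 1 → ∀ m, m = n + 1 → p + n = m →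
      ∀ (s : Fin m → A) (y : Fin m → ℚ),
      ∑ τ ∈ Finset.univ.filter (fun τ : Equiv.Perm (Fin m) =>
        ∀ i j : Fin m, i < j → 1 ≤ i.val → τ⁻¹ i < τ⁻¹ j),
          N m (fun i => s (τ i)) (fun i => y (τ i)) = 0 := by
    rintro p rfl m - rfl s y
    rw [← hN 1 n le_rfl hn s y]
    refine Finset.sum_congr (Finset.filter_congr fun τ _ => ?_) fun _ _ => rfl
    refine ⟨fun h => ⟨fun i j hij hj => by omega, h⟩, fun h => h.2⟩
  have h := key 1 rfl (n + 1) rfl (add_comm 1 n) (Fin.cons a s) (Fin.cons z y)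
  rw [sum_shuffles_one (fun τ => N (n + 1) (fun i => (Fin.cons a s : Fin (n + 1) → A) (τ i))
    (fun i => (Fin.cons z y : Fin (n + 1) → ℚ) (τ i)))] at h
  rw [← h]
  refine Finset.sum_congr rfl fun k _ => ?_
  have hins : ∀ {α : Type} (b : α) (f : Fin n → α),
      (k.insertNth b f : Fin (n + 1) → α) = fun i => (Fin.cons b f : Fin (n + 1) → α)
        (k.cycleRange i) := by
    intro α b f
    ext i
    refine Fin.succAboveCases k ?_ (fun j => ?_) i
    · simp [Fin.cycleRange_self]
    · simp [Fin.cycleRange_succAbove]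
  rw [hins, hins]

end Alternal

section Dihedral

theorem uTilde_eq_swapM (M : Mould Γ) (n : ℕ) (s : Fin (n + 2) → Γ) (y : Fin (n + 2) → ℚ) :
    uTilde M (n + 2) s y =
      swapM M (n + 1) (fun j => s j.succ) (fun j => y j.succ - y 0) := by
  have h : ¬ n + 2 ≤ 1 := by omega
  simp only [uTilde, tMap, h, if_false]
  change swapM M (n + 1) _ _ = _
  congr 1
  · funext j
    exact dif_pos (Nat.succ_lt_succ j.isLt)
  · funext j
    exact congrArg₂ (· - ·) (dif_pos (Nat.succ_lt_succ j.isLt)) (dif_pos n.succ.succ_pos)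

theorem uTilde_eq_mould (M : Mould Γ) (n : ℕ) (s : Fin (n + 2) → Γ) (y : Fin (n + 2) → ℚ) :
    uTilde M (n + 2) s y =
      M (n + 1) (fun i => ∏ j ∈ Finset.range (n + 1 - i.val), s (Fin.ofNat (n + 2) (j + 1)))
        (fun i => y (Fin.ofNat (n + 2) (n + 1 - i.val)) -
          y (Fin.ofNat (n + 2) (n + 2 - i.val))) := by
  rw [uTilde_eq_swapM]
  have hsucc : ∀ (k : ℕ) (hk : k < n + 1),
      (⟨k, hk⟩ : Fin (n + 1)).succ = Fin.ofNat (n + 2) (k + 1) := fun k hk => by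
    ext
    simp [Fin.ofNat, Nat.mod_eq_of_lt (show k + 1 < n + 2 by omega)]
  unfold swapM
  congr 1
  · funext i
    refine Finset.prod_congr rfl fun j hj => ?_
    have hj' : j < n + 1 := by have := Finset.mem_range.1 hj; omega
    simp only [extG, dif_pos hj', hsucc]
  · funext i
    have h₁ : n + 1 - 1 - i.val < n + 1 := by omega
    have h₂ : n + 1 - 1 - i.val + 1 = n + 1 - i.val := by omega
    simp only [extQ, dif_pos h₁, hsucc, h₂]
    by_cases hi : i.val = 0
    · have h₃ : ¬ n + 1 - i.val < n + 1 := by omega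
      have h₄ : Fin.ofNat (n + 2) (n + 2 - i.val) = 0 := by
        ext
        simp [hi]
      rw [dif_neg h₃, h₄, sub_zero]
    · have h₃ : n + 1 - i.val < n + 1 := by omega
      have h₄ : n + 1 - i.val + 1 = n + 2 - i.val := by omega
      rw [dif_pos h₃, h₄]
      ring

theorem uTilde_reverse {M : Mould Γ} (hM : IsAlternal (swapM M)) (n : ℕ)
    (s : Fin (n + 2) → Γ) (y : Fin (n + 2) → ℚ) :
    uTilde M (n + 2) s y =
      (-1) ^ n * uTilde M (n + 2) (fun k => s (-k)) (fun k => y (-k)) := by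
  have h : ∀ i : Fin (n + 1), i.rev.succ = -i.succ := fun i => by
    ext
    rw [Fin.val_neg', Fin.val_succ, Fin.val_succ, Fin.val_rev, Nat.mod_eq_of_lt (by omega)]
    omega
  simp only [uTilde_eq_swapM, neg_zero, ← h]
  exact hM.eq_reverse n _ _

theorem one_sub_ofNat {n a b : ℕ} (h : a + b = n + 3) :
    1 - Fin.ofNat (n + 2) b = Fin.ofNat (n + 2) a := by
  rw [sub_eq_iff_eq_add]
  ext
  simp [Fin.val_add, Fin.ofNat, h, show n + 3 = 1 + (n + 2) by omega]

theorem prod_ofNat_succ {n : ℕ} {s : Fin (n + 2) → Γ} (hs : ∏ i, s i = 1) (i : Fin (n + 1)) :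
    ∏ j ∈ Finset.range (i.val + 1), s (Fin.ofNat (n + 2) (j + 1)) =
      ∏ j ∈ Finset.range (n + 1 - i.val), (s (1 - Fin.ofNat (n + 2) (j + 1)))⁻¹ := by
  have htotal : ∏ j ∈ Finset.range (n + 2), s (Fin.ofNat (n + 2) (j + 1)) = 1 := by
    rw [← Fin.prod_univ_eq_prod_range (fun j => s (Fin.ofNat (n + 2) (j + 1))) (n + 2), ← hs,
      ← Equiv.prod_comp (Equiv.addRight (1 : Fin (n + 2))) s]
    refine Finset.prod_congr rfl fun k _ => congrArg s ?_
    ext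
    simp [Fin.val_add, Fin.ofNat]
  have hsplit := Finset.prod_range_add (fun j => s (Fin.ofNat (n + 2) (j + 1)))
    (i.val + 1) (n + 1 - i.val)
  rw [show i.val + 1 + (n + 1 - i.val) = n + 2 by omega, htotal, ← Finset.prod_range_reflect
    (fun j => s (Fin.ofNat (n + 2) (i.val + 1 + j + 1)))] at hsplit
  rw [Finset.prod_inv_distrib, eq_inv_iff_mul_eq_one, hsplit]
  congr 1
  refine Finset.prod_congr rfl fun j hj => ?_
  have hj' := Finset.mem_range.1 hj
  rw [one_sub_ofNat (a := i.val + 1 + (n + 1 - i.val - 1 - j) + 1) (by omega)]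

theorem uTilde_push {M : Mould Γ} (hM : IsAlternal M) (n : ℕ) {s : Fin (n + 2) → Γ}
    (hs : ∏ i, s i = 1) (y : Fin (n + 2) → ℚ) :
    uTilde M (n + 2) s y =
      (-1) ^ n * uTilde M (n + 2) (fun k => (s (1 - k))⁻¹) (fun k => -y (1 - k)) := by
  rw [uTilde_eq_mould, uTilde_eq_mould, hM.eq_reverse n]
  congr 2
  · funext i
    rw [← prod_ofNat_succ hs i, Fin.val_rev]
    congr 2
    omega
  · funext i
    have h₁ : n + 1 - i.rev.val = i.val + 1 := by rw [Fin.val_rev]; omega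
    have h₂ : n + 2 - i.rev.val = i.val + 2 := by rw [Fin.val_rev]; omega
    have h₃ : 1 - Fin.ofNat (n + 2) (n + 1 - i.val) = Fin.ofNat (n + 2) (i.val + 2) :=
      one_sub_ofNat (by omega)
    have h₄ : 1 - Fin.ofNat (n + 2) (n + 2 - i.val) = Fin.ofNat (n + 2) (i.val + 1) :=
      one_sub_ofNat (by omega)
    rw [h₁, h₂, h₃, h₄]
    ring

theorem uTilde_inv_cyclic {M : Mould Γ} (hM : IsAlternal M) (hM' : IsAlternal (swapM M)) (n : ℕ)
    {s : Fin (n + 2) → Γ} (hs : ∏ i, s i = 1) (y : Fin (n + 2) → ℚ) :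
    uTilde M (n + 2) s y =
      uTilde M (n + 2) (fun k => (s (k + 1))⁻¹) (fun k => -y (k + 1)) := by
  rw [uTilde_push hM n hs, uTilde_reverse hM' n, ← mul_assoc, ← mul_pow]
  simp [sub_neg_eq_add, add_comm]

theorem uTilde_sum_insertNth {M : Mould Γ} (hM : IsAlternal (swapM M)) {n : ℕ} (hn : 1 ≤ n)
    (a : Γ) (z : ℚ) (s : Fin (n + 1) → Γ) (y : Fin (n + 1) → ℚ) :
    ∑ k : Fin (n + 1), uTilde M (n + 2) (k.succ.insertNth a s) (k.succ.insertNth z y) = 0 := by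
  rw [← hM.sum_insertNth hn a (z - y 0) (fun j => s j.succ) (fun j => y j.succ - y 0)]
  refine Finset.sum_congr rfl fun k _ => ?_
  have hzero : (k.succ.insertNth z y : Fin (n + 2) → ℚ) 0 = y 0 := by
    rw [← Fin.succ_succAbove_zero k, Fin.insertNth_apply_succAbove]
  rw [uTilde_eq_swapM, hzero]
  congr 1 <;> funext j <;> refine Fin.succAboveCases k ?_ (fun i => ?_) j
  · simp
  · rw [← Fin.succ_succAbove_succ]
    simp only [Fin.insertNth_apply_succAbove]
  · simp
  · rw [← Fin.succ_succAbove_succ]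
    simp only [Fin.insertNth_apply_succAbove]

theorem insertNth_add_one {α : Type} {n : ℕ} (i : Fin n) (a : α) (f : Fin (n + 1) → α) :
    (i.castSucc.succ.insertNth a (fun j => f (j + 1)) : Fin (n + 2) → α) =
      fun k => (i.succ.succ.insertNth a f : Fin (n + 2) → α) (k + 1) := by
  funext k
  refine Fin.succAboveCases i.castSucc.succ ?_ (fun j => ?_) k
  · have h : i.castSucc.succ + 1 = i.succ.succ := by
      ext
      simp [Fin.val_add_one, Fin.ext_iff]
      omega
    rw [h, Fin.insertNth_apply_same, Fin.insertNth_apply_same]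
  · have h : i.castSucc.succ.succAbove j + 1 = i.succ.succ.succAbove (j + 1) := by
      ext
      simp only [Fin.val_add_one, Fin.succAbove, Fin.ext_iff, Fin.lt_def, Fin.val_castSucc,
        Fin.val_succ, Fin.val_last, apply_ite Fin.val]
      split_ifs <;> simp_all <;> omega
    rw [h, Fin.insertNth_apply_succAbove, Fin.insertNth_apply_succAbove]

theorem insertNth_last_add_one {α : Type} {n : ℕ} (a : α) (f : Fin (n + 1) → α) :
    ((Fin.last n).succ.insertNth a (fun j => f (j + 1)) : Fin (n + 2) → α) =
      fun k => ((0 : Fin (n + 1)).succ.insertNth a f : Fin (n + 2) → α) (k + 1 + 1) := by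
  funext k
  refine Fin.succAboveCases (Fin.last n).succ ?_ (fun j => ?_) k
  · have h : (Fin.last n).succ + 1 + 1 = (0 : Fin (n + 1)).succ := by
      simp
    rw [h, Fin.insertNth_apply_same, Fin.insertNth_apply_same]
  · have h : (Fin.last n).succ.succAbove j + 1 + 1 = (0 : Fin (n + 1)).succ.succAbove (j + 1) := by
      ext
      simp only [Fin.val_add_one, Fin.succAbove, Fin.ext_iff, Fin.lt_def, Fin.val_castSucc,
        Fin.val_succ, Fin.val_last, apply_ite Fin.val]
      split_ifs <;> simp_all <;> omega
    rw [h, Fin.insertNth_apply_succAbove, Fin.insertNth_apply_succAbove]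

theorem insertNth_map {α β : Type} {n : ℕ} (g : α → β) (k : Fin (n + 1)) (a : α)
    (f : Fin n → α) :
    (k.insertNth (g a) (fun j => g (f j)) : Fin (n + 1) → β) =
      fun i => g ((k.insertNth a f : Fin (n + 1) → α) i) := by
  funext i
  refine Fin.succAboveCases k ?_ (fun j => ?_) i <;> simp

theorem prod_insertNth {n : ℕ} (k : Fin (n + 1)) (a : Γ) (s : Fin n → Γ) :
    ∏ i, (k.insertNth a s : Fin (n + 1) → Γ) i = a * ∏ i, s i := by
  simp [Fin.prod_univ_succAbove _ k]

theorem prod_add_one {n : ℕ} (s : Fin (n + 1) → Γ) : ∏ k, s (k + 1) = ∏ k, s k :=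
  Equiv.prod_comp (Equiv.addRight (1 : Fin (n + 1))) s

theorem uTilde_inv {M : Mould Γ} (hM : IsAlternal M) (hM' : IsAlternal (swapM M)) {n : ℕ}
    (hn : 1 ≤ n) {s : Fin (n + 2) → Γ} (hs : ∏ i, s i = 1) (y : Fin (n + 2) → ℚ) :
    uTilde M (n + 2) s y = uTilde M (n + 2) (fun k => (s k)⁻¹) (fun k => -y k) := by
  obtain ⟨a, s, rfl⟩ : ∃ a t, (0 : Fin (n + 1)).succ.insertNth a t = s :=
    ⟨_, _, Fin.insertNth_self_removeNth _ s⟩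
  obtain ⟨z, y, rfl⟩ : ∃ z t, (0 : Fin (n + 1)).succ.insertNth z t = y :=
    ⟨_, _, Fin.insertNth_self_removeNth _ y⟩
  have hprod : ∀ k : Fin (n + 2), ∏ i, (k.insertNth a s : Fin (n + 2) → Γ) i = 1 := fun k => by
    rw [prod_insertNth, ← prod_insertNth (0 : Fin (n + 1)).succ, hs]
  have hrot : ∀ {t : Fin (n + 2) → Γ} (_ : ∏ i, t i = 1) (v : Fin (n + 2) → ℚ),
      uTilde M (n + 2) (fun k => t (k + 1)) (fun k => v (k + 1)) =
        uTilde M (n + 2) (fun k => (t k)⁻¹) (fun k => -v k) := fun {t} ht v => by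
    rw [uTilde_inv_cyclic hM hM' n (s := fun k => (t k)⁻¹) (by simp [ht])]
    simp
  have hrot₂ : ∀ {t : Fin (n + 2) → Γ} (_ : ∏ i, t i = 1) (v : Fin (n + 2) → ℚ),
      uTilde M (n + 2) (fun k => t (k + 1 + 1)) (fun k => v (k + 1 + 1)) =
        uTilde M (n + 2) t v := fun {t} ht v => by
    rw [hrot (t := fun k => t (k + 1)) (by rw [prod_add_one, ht]) (fun k => v (k + 1)),
      ← uTilde_inv_cyclic hM hM' n ht]
  have h₁ := uTilde_sum_insertNth hM' hn a⁻¹ (-z) (fun j => (s j)⁻¹) (fun j => -y j)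
  have h₂ := uTilde_sum_insertNth hM' hn a z (fun j => s (j + 1)) (fun j => y (j + 1))
  simp only [insertNth_map (fun g : Γ => g⁻¹), insertNth_map (fun t : ℚ => -t)] at h₁
  rw [Fin.sum_univ_succ] at h₁
  rw [Fin.sum_univ_castSucc] at h₂
  simp only [insertNth_add_one, insertNth_last_add_one, hrot (hprod _), hrot₂ hs] at h₂
  linarith

theorem uTilde_cyclic {M : Mould Γ} (hM : IsAlternal M) (hM' : IsAlternal (swapM M)) {n : ℕ}
    (hn : 1 ≤ n) {s : Fin (n + 2) → Γ} (hs : ∏ i, s i = 1) (y : Fin (n + 2) → ℚ) :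
    uTilde M (n + 2) s y = uTilde M (n + 2) (fun k => s (k + 1)) (fun k => y (k + 1)) := by
  rw [uTilde_inv_cyclic hM hM' n hs, uTilde_inv hM hM' hn (s := fun k => s (k + 1))
    (by rw [prod_add_one, hs])]

theorem uTilde_reflect {M : Mould Γ} (hM : IsAlternal M) (hM' : IsAlternal (swapM M)) {n : ℕ}
    (hn : 1 ≤ n) {s : Fin (n + 2) → Γ} (hs : ∏ i, s i = 1) (y : Fin (n + 2) → ℚ) :
    uTilde M (n + 2) s y = (-1) ^ n *
      uTilde M (n + 2) (fun k => (s (-1 - 1 - k))⁻¹) (fun k => -y (-1 - 1 - k)) := by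
  have hprod : ∏ k, s (k - 1) = 1 := by
    rw [← hs]
    exact Equiv.prod_comp (Equiv.subRight (1 : Fin (n + 2))) s
  have hprod' : ∏ k, s (k - 1 - 1) = 1 := by
    rw [← hprod]
    exact Equiv.prod_comp (Equiv.subRight (1 : Fin (n + 2))) (fun k => s (k - 1))
  have h₁ := uTilde_cyclic hM hM' hn hprod (fun k => y (k - 1))
  have h₂ := uTilde_cyclic hM hM' hn hprod' (fun k => y (k - 1 - 1))
  simp only [add_sub_cancel_right] at h₁ h₂
  rw [← h₁, ← h₂, uTilde_inv hM hM' hn hprod', uTilde_reverse hM' n]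
  congr 2 <;> funext k
  · rw [show -k - 1 - 1 = -1 - 1 - k by abel]
  · rw [show -k - 1 - 1 = -1 - 1 - k by abel]

end Dihedral

/-- Lemma: for a bialternal `M ∈ ARI(Γ)`, `m ≥ 3` and `σ₁⋯σₘ = 1`,
`ũ(M)` satisfies the cyclic symmetry, inversion and reflection relations. -/
theorem uTilde_dihedral (Γ : Type) [CommGroup Γ] [Fintype Γ]
    (M : Mould Γ) (hM : IsARI M) (hbal : IsBialternal M)
    (m : ℕ) (hm : 3 ≤ m) (σ : Fin m → Γ) (hσ : ∏ i, σ i = 1) (x : Fin m → ℚ) :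
    (uTilde M m σ x =
      uTilde M m (fun j => extG σ ((j.val + 1) % m))
        (fun j => extQ x ((j.val + 1) % m))) ∧
    (uTilde M m σ x = uTilde M m (fun j => (σ j)⁻¹) (fun j => -(x j))) ∧
    (uTilde M m σ x = (-1 : ℚ) ^ m *
      uTilde M m
        (fun j => if j.val = m - 1 then (σ j)⁻¹ else (extG σ (m - 2 - j.val))⁻¹)
        (fun j => if j.val = m - 1 then -(x j) else -(extQ x (m - 2 - j.val)))) := by
  obtain ⟨n, rfl⟩ := Nat.exists_eq_add_of_le' (show 2 ≤ m by omega)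
  have hn : 1 ≤ n := by omega
  have hG : ∀ k (hk : k < n + 2), extG σ k = σ ⟨k, hk⟩ := fun k hk => dif_pos hk
  have hQ : ∀ k (hk : k < n + 2), extQ x k = x ⟨k, hk⟩ := fun k hk => dif_pos hk
  have hsucc : ∀ (j : Fin (n + 2)) (h : (j.val + 1) % (n + 2) < n + 2),
      (⟨(j.val + 1) % (n + 2), h⟩ : Fin (n + 2)) = j + 1 := fun j h => by
    ext
    simp [Fin.val_add]
  have hlast : ∀ j : Fin (n + 2), j.val = n + 2 - 1 → -1 - 1 - j = j := fun j hj => by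
    obtain rfl : j = -1 := by
      ext
      rw [hj, Fin.coe_neg_one]
      rfl
    abel
  have hrefl : ∀ (j : Fin (n + 2)) (h : n + 2 - 2 - j.val < n + 2), j.val ≠ n + 2 - 1 →
      -1 - 1 - j = ⟨n + 2 - 2 - j.val, h⟩ := fun j h hj => by
    rw [sub_eq_iff_eq_add, sub_eq_iff_eq_add]
    ext
    rw [Fin.coe_neg_one, Fin.val_add_one, Fin.val_add]
    simp only [Fin.ext_iff, Fin.val_add, Fin.val_last]
    rw [Nat.mod_eq_of_lt (by omega)]
    split_ifs <;> omega
  obtain ⟨hM₁, hM₂, -⟩ := hbal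
  refine ⟨?_, uTilde_inv hM₁ hM₂ hn hσ x, ?_⟩
  · rw [uTilde_cyclic hM₁ hM₂ hn hσ x]
    congr 1 <;> funext j
    · rw [hG _ (Nat.mod_lt _ (by omega)), hsucc]
    · rw [hQ _ (Nat.mod_lt _ (by omega)), hsucc]
  · rw [uTilde_reflect hM₁ hM₂ hn hσ x, pow_add, neg_one_sq, mul_one]
    congr 2 <;> funext j <;> split_ifs with hj
    · rw [hlast j hj]
    · rw [hG _ (by omega), hrefl j (by omega) hj]
    · rw [hlast j hj]
    · rw [hQ _ (by omega), hrefl j (by omega) hj]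

end KVMould
end

section
/- Theorem (embedding of bialternal moulds): If M ∈ ARI(Γ) is bialternal and its depth-1 component vanishes (M^1 = 0), then M is push-invariant and swap(M) is pus-neutral; in other words, the depth-≥2 part of the space of bialternal moulds is contained in ARI(Γ)_{push/pusnu}, and this inclusion is a homomorphism of Lie algebras for the ari_u-bracket. -/
namespace KVMould

variable {Γ : Type} [CommGroup Γ]

/-- A permutation decreasing on `[0, k)` and increasing on `[k, m)`. -/
def IsValley {m : ℕ} (k : ℕ) (ρ : Equiv.Perm (Fin m)) : Prop :=
  (∀ i j : Fin m, i < j → j.val < k → ρ j < ρ i) ∧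
    ∀ i j : Fin m, i < j → k ≤ i.val → ρ i < ρ j

/-- The involution of `Fin (p + q)` reversing the initial segment `[0, p)`. -/
def revInit (p q : ℕ) : Equiv.Perm (Fin (p + q)) :=
  Function.Involutive.toPerm
    (fun i => ⟨if i.val < p then p - 1 - i.val else i.val, by split_ifs <;> omega⟩) (by
      intro i
      ext
      dsimp only
      split_ifs <;> omega)

theorem revInit_val {p q : ℕ} (i : Fin (p + q)) :
    (revInit p q i).val = if i.val < p then p - 1 - i.val else i.val :=
  rfl

theorem revInit_mul_self (p q : ℕ) : revInit p q * revInit p q = 1 := by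
  ext i
  simp only [Equiv.Perm.mul_apply, revInit_val, Equiv.Perm.one_apply]
  split_ifs <;> omega

theorem revInit_inv (p q : ℕ) : (revInit p q)⁻¹ = revInit p q :=
  inv_eq_of_mul_eq_one_left (revInit_mul_self p q)

theorem revInit_revInit {p q : ℕ} (i : Fin (p + q)) : revInit p q (revInit p q i) = i := by
  rw [← Equiv.Perm.mul_apply, revInit_mul_self, Equiv.Perm.one_apply]

theorem isValley_iff {p q : ℕ} (τ : Equiv.Perm (Fin (p + q))) :
    IsValley p (revInit p q * τ)⁻¹ ↔ τ ∈ shuffles p q := by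
  simp only [IsValley, shuffles, Finset.mem_filter, Finset.mem_univ, true_and, mul_inv_rev,
    revInit_inv, Equiv.Perm.mul_apply]
  refine and_congr ⟨fun h i j hij hj => ?_, fun h i j hij hj => ?_⟩
    ⟨fun h i j hij hi => ?_, fun h i j hij hi => ?_⟩
  · have := h (revInit p q j) (revInit p q i)
      (by rw [Fin.lt_def, revInit_val, revInit_val]; split_ifs <;> omega)
      (by rw [revInit_val]; split_ifs <;> omega)
    rwa [revInit_revInit, revInit_revInit] at this
  · exact h (revInit p q j) (revInit p q i)
      (by rw [Fin.lt_def] at hij; rw [revInit_val, revInit_val]; split_ifs <;> omega)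
      (by rw [Fin.lt_def] at hij; rw [revInit_val]; split_ifs <;> omega)
  · have := h (revInit p q i) (revInit p q j)
      (by rw [Fin.lt_def, revInit_val, revInit_val]; split_ifs <;> omega)
      (by rw [revInit_val]; split_ifs <;> omega)
    rwa [revInit_revInit, revInit_revInit] at this
  · exact h (revInit p q i) (revInit p q j)
      (by rw [Fin.lt_def] at hij; rw [revInit_val, revInit_val]; split_ifs <;> omega)
      (by rw [Fin.lt_def] at hij; rw [revInit_val]; split_ifs <;> omega)

open Classical in
/-- The sum of an alternal mould over the shuffles of the reversed prefix of length `k` with the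
remaining suffix vanishes. -/
theorem sum_valley_eq_zero {Γ : Type} {M : Mould Γ} (hM : IsAlternal M) {m k : ℕ}
    (hk : 0 < k) (hkm : k < m) (σ : Fin m → Γ) (x : Fin m → ℚ) :
    ∑ ρ : Equiv.Perm (Fin m),
      (if IsValley k ρ then M m (fun i => σ (ρ⁻¹ i)) (fun i => x (ρ⁻¹ i)) else 0) = 0 := by
  obtain ⟨q, rfl⟩ := Nat.exists_eq_add_of_le hkm.le
  refine Eq.trans ?_
    (hM k q hk (by omega) (fun i => σ (revInit k q i)) (fun i => x (revInit k q i)))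
  rw [← Finset.sum_filter]
  symm
  refine Finset.sum_bij (fun τ _ => (revInit k q * τ)⁻¹) (fun τ hτ => ?_) (fun τ _ τ' _ h => ?_)
    (fun ρ hρ => ⟨revInit k q * ρ⁻¹, ?_, ?_⟩) (fun τ _ => ?_)
  · exact Finset.mem_filter.2 ⟨Finset.mem_univ _, (isValley_iff τ).2 hτ⟩
  · simpa using h
  · refine (isValley_iff _).1 ?_
    rw [← mul_assoc, revInit_mul_self, one_mul, inv_inv]
    exact (Finset.mem_filter.1 hρ).2
  · rw [← mul_assoc, revInit_mul_self, one_mul, inv_inv]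
  · simp only [inv_inv, Equiv.Perm.mul_apply]

open Classical in
theorem sum_sign_isValley {n : ℕ} (ρ : Equiv.Perm (Fin (n + 1))) :
    ∑ k ∈ Finset.range (n + 2), (if IsValley k ρ then (-1 : ℚ) ^ k else 0) = 0 := by
  set p := ρ⁻¹ 0 with hp
  have hp0 : ρ p = 0 := by simp [hp]
  have hpos : ∀ i, i ≠ p → 0 < ρ i := fun i hi =>
    Fin.pos_iff_ne_zero.2 fun h => hi (ρ.injective (h.trans hp0.symm))
  have hcases : ∀ k, k ≤ n + 1 → IsValley k ρ → k = p.val ∨ k = p.val + 1 := by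
    intro k hk h
    by_contra! hne
    rcases lt_or_ge p.val k with hlt | hge
    · have := h.1 p ⟨p.val + 1, by omega⟩ (Nat.lt_succ_self _) (by simp; omega)
      simp [hp0] at this
    · have := h.2 ⟨p.val - 1, by omega⟩ p (show p.val - 1 < p.val by omega)
        (show k ≤ p.val - 1 by omega)
      simp [hp0] at this
  have hiff : IsValley p.val ρ ↔ IsValley (p.val + 1) ρ := by
    constructor
    · refine fun h => ⟨fun i j hij hj => ?_, fun i j hij hi => h.2 i j hij (by omega)⟩
      by_cases hjp : j = p
      · rw [hjp, hp0]
        exact hpos i (by rintro rfl; simp [hjp] at hij)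
      · exact h.1 i j hij (by have := Fin.val_ne_of_ne hjp; omega)
    · refine fun h => ⟨fun i j hij hj => h.1 i j hij (by omega), fun i j hij hi => ?_⟩
      by_cases hip : i = p
      · rw [hip, hp0]
        exact hpos j (by rintro rfl; simp [hip] at hij)
      · exact h.2 i j hij (by have := Fin.val_ne_of_ne hip; omega)
  rw [← Finset.sum_subset (s₁ := {p.val, p.val + 1})]
  · rw [Finset.sum_pair (by omega), ← hiff]
    split_ifs <;> ring
  · intro k hk
    simp only [Finset.mem_insert, Finset.mem_singleton] at hk
    simp only [Finset.mem_range]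
    omega
  · intro k hk hk'
    rw [if_neg]
    intro h
    have := hcases k (by simp at hk; omega) h
    simp at hk'
    omega

theorem isValley_zero_iff {m : ℕ} (ρ : Equiv.Perm (Fin m)) : IsValley 0 ρ ↔ ρ = 1 := by
  constructor
  · intro h
    have h1 : StrictMono ρ := fun i j hij => h.2 i j hij (Nat.zero_le _)
    ext i
    have := (h1.range_inj strictMono_id).1 (by simp [ρ.surjective.range_eq])
    simp [this]
  · rintro rfl
    exact ⟨fun i j _ h => absurd h (by omega), fun i j hij _ => hij⟩

theorem isValley_self_iff {m : ℕ} (ρ : Equiv.Perm (Fin m)) : IsValley m ρ ↔ ρ = Fin.revPerm := by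
  constructor
  · intro h
    have h1 : StrictMono (fun i : Fin m => ρ i.rev) := fun i j hij =>
      h.1 _ _ (Fin.rev_lt_rev.2 hij) (by omega)
    have := (h1.range_inj strictMono_id).1
      ((ρ.surjective.comp Fin.rev_surjective).range_eq.trans Set.range_id.symm)
    ext i
    have := congrFun this i.rev
    simp at this
    simp [this]
  · rintro rfl
    exact ⟨fun i j hij _ => by simpa using hij, fun i j _ h => absurd h (by omega)⟩

/-- Alternal moulds are invariant under `mantar`. -/
theorem IsAlternal.rev {Γ : Type} {M : Mould Γ} (hM : IsAlternal M) {n : ℕ} (σ : Fin (n + 1) → Γ)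
    (x : Fin (n + 1) → ℚ) :
    M (n + 1) (fun i => σ i.rev) (fun i => x i.rev) = (-1) ^ n * M (n + 1) σ x := by
  classical
  let f : ℕ → Equiv.Perm (Fin (n + 1)) → ℚ := fun k ρ =>
    if IsValley k ρ then M (n + 1) (fun i => σ (ρ⁻¹ i)) (fun i => x (ρ⁻¹ i)) else 0
  have h : ∑ k ∈ Finset.range (n + 2), (-1 : ℚ) ^ k * ∑ ρ, f k ρ = 0 := by
    simp only [Finset.mul_sum]
    rw [Finset.sum_comm]
    refine Finset.sum_eq_zero fun ρ _ => ?_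
    have := congrArg (· * M (n + 1) (fun i => σ (ρ⁻¹ i)) (fun i => x (ρ⁻¹ i)))
      (sum_sign_isValley ρ)
    simpa [f, Finset.sum_mul] using this
  rw [Finset.sum_range_succ, Finset.sum_range_succ', Finset.sum_eq_zero (fun k hk => ?_)] at h
  · have h0 : ∑ ρ, f 0 ρ = M (n + 1) σ x := by
      simp only [f, isValley_zero_iff, Finset.sum_ite_eq', Finset.mem_univ, if_true]
      rfl
    have h1 : ∑ ρ, f (n + 1) ρ = M (n + 1) (fun i => σ i.rev) (fun i => x i.rev) := by
      simp only [f, isValley_self_iff, Finset.sum_ite_eq', Finset.mem_univ, if_true]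
      rfl
    rw [h0, h1] at h
    have hs : ((-1 : ℚ) ^ n) * (-1) ^ n = 1 := by rw [← mul_pow]; simp
    rw [pow_succ] at h
    linear_combination (-(-1 : ℚ) ^ n) * h + M (n + 1) (fun i => σ i.rev) (fun i => x i.rev) * (-hs)
  · rw [sum_valley_eq_zero hM (by omega) (by simp at hk; omega), mul_zero]

/-- The sequence `w` with the letter `t` inserted at position `j`. -/
def insSeq {α : Type} (j : ℕ) (t : α) (w : ℕ → α) : ℕ → α :=
  fun i => if i < j then w i else if i = j then t else w (i - 1)

/-- The permutation of `Fin (n + 1)` moving the last element to `j`, preserving the order of the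
others. -/
def moveLast {n : ℕ} (j : Fin (n + 1)) : Equiv.Perm (Fin (n + 1)) :=
  (finSuccEquiv' (Fin.last n)).trans (finSuccEquiv' j).symm

theorem moveLast_last {n : ℕ} (j : Fin (n + 1)) : moveLast j (Fin.last n) = j := by
  simp [moveLast]

theorem moveLast_castSucc {n : ℕ} (j : Fin (n + 1)) (i : Fin n) :
    moveLast j i.castSucc = j.succAbove i := by
  simp [moveLast, finSuccEquiv'_last_apply_castSucc]

theorem mem_shuffles_one_iff {n : ℕ} (τ : Equiv.Perm (Fin (n + 1))) :
    τ ∈ shuffles n 1 ↔ τ = (moveLast (τ⁻¹ (Fin.last n)))⁻¹ := by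
  simp only [shuffles, Finset.mem_filter, Finset.mem_univ, true_and]
  constructor
  · rintro ⟨h, -⟩
    set j := τ⁻¹ (Fin.last n) with hj
    have hm : StrictMono fun i : Fin n => τ⁻¹ i.castSucc := fun i i' hi => h _ _ hi i'.isLt
    have hr : Set.range (fun i : Fin n => τ⁻¹ i.castSucc) = Set.range j.succAbove := by
      rw [Fin.range_succAbove]
      ext y
      simp only [Set.mem_range, Set.mem_compl_iff, Set.mem_singleton_iff, hj]
      constructor
      · rintro ⟨i, rfl⟩ h'
        exact (Fin.castSucc_lt_last i).ne (τ⁻¹.injective h')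
      · intro hy
        have : τ y ≠ Fin.last n := fun h' => hy (by rw [← h']; simp)
        exact ⟨(τ y).castPred this, by simp⟩
    have he := (hm.range_inj (Fin.strictMono_succAbove j)).1 hr
    rw [eq_comm, inv_eq_iff_eq_inv]
    refine Equiv.ext fun i => ?_
    induction i using Fin.lastCases with
    | last => rw [moveLast_last]
    | cast i => rw [moveLast_castSucc]; exact (congrFun he i).symm
  · intro h
    rw [h, inv_inv]
    set j := τ⁻¹ (Fin.last n)
    refine ⟨fun i i' hi hi' => ?_, fun i i' hi hi' => absurd i'.isLt (by omega)⟩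
    have h' : moveLast j (Fin.castSucc ⟨i, hi.trans hi'⟩) < moveLast j (Fin.castSucc ⟨i', hi'⟩) := by
      rw [moveLast_castSucc, moveLast_castSucc]
      exact Fin.strictMono_succAbove j hi
    exact h'

theorem apply_moveLast_inv {α : Type} {n : ℕ} (j : Fin (n + 1)) (w : ℕ → α) (t : α)
    (i : Fin (n + 1)) :
    insSeq n t w ((moveLast j)⁻¹ i).val = insSeq j t w i := by
  obtain ⟨k, rfl⟩ := (moveLast j).surjective i
  rw [← Equiv.Perm.mul_apply, inv_mul_cancel, Equiv.Perm.one_apply]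
  induction k using Fin.lastCases with
  | last => simp [moveLast_last, insSeq]
  | cast k =>
    rw [moveLast_castSucc]
    rcases lt_or_ge k.castSucc j with h | h
    · rw [Fin.succAbove_of_castSucc_lt _ _ h]
      rw [Fin.lt_def] at h
      simp only [Fin.val_castSucc] at h
      simp [insSeq, h]
    · rw [Fin.succAbove_of_le_castSucc _ _ h]
      rw [Fin.le_def] at h
      simp only [Fin.val_castSucc] at h
      have h1 : ¬ (k.val + 1 < j.val) := by omega
      have h2 : ¬ (k.val + 1 = j.val) := by omega
      simp [insSeq, h1, h2]

/-- Alternality for the shuffles of a word with a single letter. -/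
theorem IsAlternal.sum_insSeq {Γ : Type} {N : Mould Γ} (hN : IsAlternal N) {n : ℕ} (hn : 1 ≤ n)
    (g : Γ) (s : ℕ → Γ) (t : ℚ) (v : ℕ → ℚ) :
    ∑ j ∈ Finset.range (n + 1),
      N (n + 1) (fun i => insSeq j g s i) (fun i => insSeq j t v i) = 0 := by
  rw [← hN n 1 hn le_rfl (fun i => insSeq n g s i) (fun i => insSeq n t v i), Finset.sum_range]
  refine Finset.sum_bij (fun j _ => (moveLast j)⁻¹) (fun j _ => ?_) (fun j _ j' _ h => ?_)
    (fun τ hτ => ⟨τ⁻¹ (Fin.last n), Finset.mem_univ _, ?_⟩) (fun j _ => ?_)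
  · rw [mem_shuffles_one_iff, inv_inv, moveLast_last]
  · rw [← moveLast_last j, ← moveLast_last j', inv_injective h]
  · exact ((mem_shuffles_one_iff τ).1 hτ).symm
  · simp only [apply_moveLast_inv]

/-- The swap of `M` as a function of a word of `m + 1` letters in `Γ × ℚ`, the last of which is the
base point: it is invariant under translation of the rational entries. -/
def baseSwap (M : Mould Γ) (m : ℕ) (u : ℕ → Γ × ℚ) : ℚ :=
  M m (fun i => ∏ j ∈ Finset.range (m - i.val), (u j).1)
    (fun i => (u (m - 1 - i.val)).2 - (u (m - i.val)).2)

theorem baseSwap_congr (M : Mould Γ) {m : ℕ} {u u' : ℕ → Γ × ℚ} (h : ∀ i ≤ m, u i = u' i) :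
    baseSwap M m u = baseSwap M m u' := by
  unfold baseSwap
  congr 1
  · funext i
    exact Finset.prod_congr rfl fun j hj => by
      rw [h j (by have := Finset.mem_range.1 hj; omega)]
  · funext i
    rw [h _ (by omega), h _ (by omega)]

theorem swapM_eq_baseSwap (M : Mould Γ) {m : ℕ} (u : ℕ → Γ × ℚ) :
    swapM M m (fun i => (u i).1) (fun i => (u i).2 - (u m).2) = baseSwap M m u := by
  unfold baseSwap swapM
  congr 1
  · funext i
    refine Finset.prod_congr rfl fun j hj => ?_
    have := Finset.mem_range.1 hj
    rw [extG, dif_pos (by omega)]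
  · funext i
    have hi := i.isLt
    have h1 : m - 1 - i.val < m := by omega
    by_cases h : m - i.val < m
    · simp [extQ, h, h1]
    · have : m - i.val = m := by omega
      simp [extQ, h1, this]

/-- Inversion of a letter. -/
def negLetter (p : Γ × ℚ) : Γ × ℚ := (p.1⁻¹, -p.2)

/-- Reversing both `M` and its swap amounts to `neg ∘ push`, so that a cyclic rotation of a word with
trivial product has the effect of an inversion of all its letters. -/
theorem baseSwap_rotate {M : Mould Γ} (hM : IsAlternal M) (hS : IsAlternal (swapM M)) {n : ℕ}
    (u : ℕ → Γ × ℚ) (hu : ∏ j ∈ Finset.range (n + 2), (u j).1 = 1) :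
    baseSwap M (n + 1) (fun i => if i = 0 then u (n + 1) else u (i - 1)) =
      baseSwap M (n + 1) (fun i => negLetter (u i)) := by
  have hs : ((-1 : ℚ) ^ n) * (-1) ^ n = 1 := by rw [← mul_pow]; simp
  let c : ℕ → Γ × ℚ := fun i => if i ≤ n then negLetter (u (n - i)) else negLetter (u i)
  have h1 : baseSwap M (n + 1) c = (-1) ^ n * baseSwap M (n + 1) (fun i => negLetter (u i)) := by
    rw [← swapM_eq_baseSwap, ← swapM_eq_baseSwap, ← hS.rev]
    congr 1
    · funext i
      have : i.val ≤ n := by omega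
      simp [c, Fin.val_rev, this]
    · funext i
      have : i.val ≤ n := by omega
      simp [c, Fin.val_rev, this]
  have h2 : baseSwap M (n + 1) (fun i => if i = 0 then u (n + 1) else u (i - 1)) =
      (-1) ^ n * baseSwap M (n + 1) c := by
    unfold baseSwap
    rw [← hM.rev]
    congr 1
    · funext i
      have hi := i.isLt
      have e : n + 1 - (n + 1 - (i.val + 1)) = i.val + 1 := by omega
      rw [Fin.val_rev, e]
      have e2 : ∏ j ∈ Finset.range (i.val + 1), (c j).1 =
          (∏ j ∈ Finset.range (i.val + 1), (u (n - i + j)).1)⁻¹ := by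
        rw [← Finset.prod_range_reflect, ← Finset.prod_inv_distrib]
        refine Finset.prod_congr rfl fun j hj => ?_
        have := Finset.mem_range.1 hj
        have h3 : i.val + 1 - 1 - j ≤ n := by omega
        have h4 : n - (i.val + 1 - 1 - j) = n - i + j := by omega
        simp only [c, h3, if_true, negLetter, h4]
      have e3 : n + 1 - i.val = (n - i) + 1 := by omega
      have e4 := Finset.prod_range_add (fun j => (u j).1) (n - i) (i.val + 1)
      rw [show n - i.val + (i.val + 1) = n + 1 by omega] at e4
      rw [e2, e3, Finset.prod_range_succ', eq_inv_iff_mul_eq_one, ← hu,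
        Finset.prod_range_succ _ (n + 1), e4]
      simp only [Nat.succ_ne_zero, if_false, if_true, Nat.add_sub_cancel]
      exact mul_right_comm _ _ _
    · funext i
      have hi := i.isLt
      rw [Fin.val_rev]
      have e1 : n + 1 - 1 - (n + 1 - (i.val + 1)) = i.val := by omega
      have e2 : n + 1 - (n + 1 - (i.val + 1)) = i.val + 1 := by omega
      have e3 : i.val ≤ n := by omega
      rw [e1, e2]
      by_cases h : i.val = n
      · simp [c, h, negLetter]
        ring
      · have h3 : i.val + 1 ≤ n := by omega
        have h4 : ¬ (n ≤ i.val) := by omega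
        have h5 : n - i.val ≠ 0 := by omega
        have h6 : n + 1 - i.val ≠ 0 := by omega
        have h7 : n + 1 - i.val - 1 = n - i.val := by omega
        have h8 : n + 1 - 1 - i.val - 1 = n - (i.val + 1) := by omega
        have h9 : n + 1 - 1 - i.val ≠ 0 := by omega
        simp only [c, e3, h3, h9, h6, if_true, if_false, negLetter, h7, h8]
        ring
  rw [h2, h1, ← mul_assoc, hs, one_mul]

theorem sum_baseSwap_insSeq {M : Mould Γ} (hS : IsAlternal (swapM M)) {n : ℕ} (hn : 1 ≤ n)
    (t : Γ × ℚ) (w : ℕ → Γ × ℚ) :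
    ∑ j ∈ Finset.range (n + 1), baseSwap M (n + 1) (insSeq j t w) = 0 := by
  rw [← hS.sum_insSeq hn t.1 (fun i => (w i).1) (t.2 - (w n).2) (fun i => (w i).2 - (w n).2)]
  refine Finset.sum_congr rfl fun j hj => ?_
  have hj := Finset.mem_range.1 hj
  have e : insSeq j t w (n + 1) = w n := by
    simp only [insSeq]
    rw [if_neg (by omega), if_neg (by omega), Nat.add_sub_cancel]
  rw [← swapM_eq_baseSwap, e]
  congr 1 <;> funext i <;> simp only [insSeq] <;> split_ifs <;> rfl

theorem prod_range_shift {n : ℕ} {f : ℕ → Γ} (hf : ∀ i, f (i + n) = f i) :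
    ∏ i ∈ Finset.range n, f (i + 1) = ∏ i ∈ Finset.range n, f i := by
  have h := Finset.prod_range_succ f n
  rw [Finset.prod_range_succ', ← hf 0, Nat.zero_add] at h
  exact mul_right_cancel h

/-- A letter `t` and an `n`-periodic sequence `w` such that the group entries of `t` and of one
period of `w` have product `1`. -/
def IsCyclicWord (n : ℕ) (t : Γ × ℚ) (w : ℕ → Γ × ℚ) : Prop :=
  (∀ i, w (i + n) = w i) ∧ t.1 * ∏ i ∈ Finset.range n, (w i).1 = 1

theorem IsCyclicWord.shift {n : ℕ} {t : Γ × ℚ} {w : ℕ → Γ × ℚ} (h : IsCyclicWord n t w) :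
    IsCyclicWord n t (fun i => w (i + 1)) := by
  refine ⟨fun i => (congrArg w (Nat.add_right_comm i n 1)).trans (h.1 _), ?_⟩
  rw [prod_range_shift (f := fun i => (w i).1) fun i => by rw [h.1]]
  exact h.2

theorem IsCyclicWord.neg {n : ℕ} {t : Γ × ℚ} {w : ℕ → Γ × ℚ} (h : IsCyclicWord n t w) :
    IsCyclicWord n (negLetter t) (fun i => negLetter (w i)) := by
  refine ⟨fun i => congrArg negLetter (h.1 i), ?_⟩
  simp only [negLetter, Finset.prod_inv_distrib]
  rw [← mul_inv, h.2, inv_one]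

theorem IsCyclicWord.prod_insSeq {n j : ℕ} {t : Γ × ℚ} {w : ℕ → Γ × ℚ} (h : IsCyclicWord n t w)
    (hj : j ≤ n) : ∏ i ∈ Finset.range (n + 1), (insSeq j t w i).1 = 1 := by
  obtain ⟨l, rfl⟩ := Nat.exists_eq_add_of_le hj
  rw [← h.2, Nat.add_assoc, Finset.prod_range_add _ j (l + 1), Finset.prod_range_add _ j l,
    Finset.prod_range_succ' _ l, mul_left_comm t.1, mul_comm t.1]
  congr 1
  · exact Finset.prod_congr rfl fun i hi => by simp [insSeq, Finset.mem_range.1 hi]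
  · congr 1
    · refine Finset.prod_congr rfl fun i _ => ?_
      simp only [insSeq]
      rw [if_neg (by omega), if_neg (by omega)]
      rfl
    · simp [insSeq]

theorem insSeq_neg (j : ℕ) (t : Γ × ℚ) (w : ℕ → Γ × ℚ) :
    (fun i => negLetter (insSeq j t w i)) = insSeq j (negLetter t) (fun i => negLetter (w i)) := by
  funext i
  simp only [insSeq]
  split_ifs <;> rfl

theorem baseSwap_insSeq_succ {M : Mould Γ} (hM : IsAlternal M) (hS : IsAlternal (swapM M))
    {n : ℕ} {t : Γ × ℚ} {w : ℕ → Γ × ℚ} (h : IsCyclicWord (n + 1) t w) {j : ℕ} (hj : j ≤ n) :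
    baseSwap M (n + 1) (insSeq (j + 1) t w) =
      baseSwap M (n + 1) (insSeq j (negLetter t) (fun i => negLetter (w (i + 1)))) := by
  rw [← insSeq_neg j t (fun i => w (i + 1)),
    ← baseSwap_rotate hM hS _ (h.shift.prod_insSeq (by omega))]
  refine baseSwap_congr M fun i hi => ?_
  rcases i with _ | i
  · simp only [insSeq, if_true]
    rw [if_pos (by omega), if_neg (by omega), if_neg (by omega), Nat.add_sub_cancel, ← h.1 0,
      Nat.zero_add]
  · simp only [insSeq, Nat.add_sub_cancel, Nat.add_lt_add_iff_right, Nat.add_right_cancel_iff,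
      Nat.succ_ne_zero, if_false]
    split_ifs with h1 h2
    · rfl
    · rfl
    · rw [Nat.sub_add_cancel (by omega)]

theorem baseSwap_insSeq_last {M : Mould Γ} (hM : IsAlternal M) (hS : IsAlternal (swapM M))
    {n : ℕ} {t : Γ × ℚ} {w : ℕ → Γ × ℚ} (h : IsCyclicWord (n + 1) t w) :
    baseSwap M (n + 1) (insSeq 0 t w) =
      baseSwap M (n + 1) (insSeq (n + 1) (negLetter t) (fun i => negLetter (w i))) := by
  rw [← insSeq_neg, ← baseSwap_rotate hM hS _ (h.prod_insSeq le_rfl)]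
  refine baseSwap_congr M fun i hi => ?_
  rcases i with _ | i
  · simp [insSeq]
  · have : i < n + 1 := by omega
    simp [insSeq, this]

theorem baseSwap_insSeq_neg {M : Mould Γ} (hM : IsAlternal M) (hS : IsAlternal (swapM M))
    {n : ℕ} {t : Γ × ℚ} {w : ℕ → Γ × ℚ} (hn : 1 ≤ n) (h : IsCyclicWord (n + 1) t w) :
    baseSwap M (n + 1) (insSeq 0 (negLetter t) (fun i => negLetter (w i))) =
      baseSwap M (n + 1) (insSeq 0 t w) := by
  have key : ∀ {t : Γ × ℚ} {w : ℕ → Γ × ℚ}, IsCyclicWord (n + 1) t w →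
      baseSwap M (n + 1) (insSeq (n + 1) t w) = baseSwap M (n + 1) (insSeq 0 t w) := by
    intro t w h
    have h0 := sum_baseSwap_insSeq hS hn t w
    have h1 := sum_baseSwap_insSeq hS hn (negLetter t) (fun i => negLetter (w (i + 1)))
    rw [Finset.sum_congr rfl fun j hj => (baseSwap_insSeq_succ hM hS h
      (Nat.lt_succ_iff.1 (Finset.mem_range.1 hj))).symm] at h1
    have h2 := Finset.sum_range_succ (fun j => baseSwap M (n + 1) (insSeq j t w)) (n + 1)
    rw [Finset.sum_range_succ', h0, h1] at h2
    simpa using h2.symm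
  rw [baseSwap_insSeq_last hM hS h, key h.neg]

/-- Parity of bialternal moulds in depth at least `2`. -/
theorem baseSwap_neg {M : Mould Γ} (hM : IsAlternal M) (hS : IsAlternal (swapM M))
    {n : ℕ} (hn : 1 ≤ n) (u : ℕ → Γ × ℚ)
    (hu : ∏ j ∈ Finset.range (n + 2), (u j).1 = 1) :
    baseSwap M (n + 1) (fun i => negLetter (u i)) = baseSwap M (n + 1) u := by
  have e : ∀ i ≤ n + 1, u i = insSeq 0 (u 0) (fun i => u (i % (n + 1) + 1)) i := by
    intro i hi
    rcases i with _ | i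
    · simp [insSeq]
    · simp [insSeq, Nat.mod_eq_of_lt (show i < n + 1 by omega)]
  have hc : IsCyclicWord (n + 1) (u 0) (fun i => u (i % (n + 1) + 1)) := by
    refine ⟨fun i => by simp, ?_⟩
    rw [← hu, Finset.prod_range_succ' _ (n + 1), mul_comm]
    congr 1
    exact Finset.prod_congr rfl fun i hi => by
      simp only [Nat.mod_eq_of_lt (Finset.mem_range.1 hi)]
  rw [baseSwap_congr M e, ← baseSwap_insSeq_neg hM hS hn hc, ← insSeq_neg]
  exact baseSwap_congr M fun i hi => by rw [e i hi]

theorem baseSwap_insSeq {M : Mould Γ} (hM : IsAlternal M) (hS : IsAlternal (swapM M))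
    {n : ℕ} {t : Γ × ℚ} {w : ℕ → Γ × ℚ} (hn : 1 ≤ n) (h : IsCyclicWord (n + 1) t w)
    {j : ℕ} (hj : j ≤ n + 1) :
    baseSwap M (n + 1) (insSeq j t w) =
      baseSwap M (n + 1) (insSeq 0 t (fun i => w (i + j))) := by
  induction j generalizing w with
  | zero => rfl
  | succ j ih =>
    rw [baseSwap_insSeq_succ hM hS h (by omega), ← insSeq_neg j t (fun i => w (i + 1)),
      baseSwap_neg hM hS hn _ (h.shift.prod_insSeq (by omega)), ih h.shift (by omega)]
    simp only [Nat.add_assoc]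

theorem pushM_eq_of_bialternal {M : Mould Γ} (hM : IsAlternal M) (hS : IsAlternal (swapM M))
    {n : ℕ} (hn : 1 ≤ n) (σ : Fin (n + 1) → Γ) (x : Fin (n + 1) → ℚ) :
    pushM M (n + 1) σ x = M (n + 1) σ x := by
  let p : ℕ → Γ := fun k => if k ≤ n + 1 then extG σ (n + 1 - k) else 1
  let u : ℕ → Γ × ℚ := fun i =>
    (p (i + 1) / p i, ∑ l ∈ Finset.range (n + 1 - i), extQ x l)
  have hp0 : p 0 = 1 := by simp [p, extG]
  have hprod : ∀ k, ∏ j ∈ Finset.range k, (u j).1 = p k := fun k => by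
    simp only [u, Finset.prod_range_div, hp0, div_one]
  have hp : ∀ i < n + 1, p (n + 1 - i) = extG σ i := fun i hi => by
    simp only [p]
    rw [if_pos (by omega)]
    congr 1
    omega
  let u' : ℕ → Γ × ℚ := fun i => if i = n + 1 then u 0 else u (i + 1)
  have hu' : ∏ j ∈ Finset.range (n + 2), (u' j).1 = 1 := by
    rw [Finset.prod_range_succ]
    have : p (n + 2) = 1 := by simp [p]
    rw [← this, ← hprod, Finset.prod_range_succ' _ (n + 1)]
    simp only [u', if_true]
    congr 1
    exact Finset.prod_congr rfl fun i hi => by rw [if_neg (Finset.mem_range.1 hi).ne]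
  have h1 : baseSwap M (n + 1) u = M (n + 1) σ x := by
    unfold baseSwap
    congr 1
    · funext i
      rw [hprod, hp i i.isLt, extG, dif_pos i.isLt]
    · funext i
      have hi := i.isLt
      simp only [u]
      rw [show n + 1 - (n + 1 - 1 - i.val) = i + 1 by omega,
        show n + 1 - (n + 1 - i.val) = i by omega, Finset.sum_range_succ,
        add_sub_cancel_left, extQ, dif_pos hi]
  have h2 : baseSwap M (n + 1) u' = pushM M (n + 1) σ x := by
    unfold baseSwap pushM
    congr 1
    · funext i
      have hi := i.isLt
      have e : ∏ j ∈ Finset.range (n + 1 - i.val), (u' j).1 =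
          p (n + 1 - i + 1) * (extG σ (n + 1 - 1))⁻¹ := by
        rw [← hprod, Finset.prod_range_succ', eq_mul_inv_iff_mul_eq]
        congr 1
        · refine Finset.prod_congr rfl fun j hj => ?_
          have := Finset.mem_range.1 hj
          simp only [u']
          rw [if_neg (by omega)]
        · simp [u, hp0, p]
      rw [e]
      split_ifs with h
      · simp [h, p]
      · rw [show n + 1 - i.val + 1 = n + 1 - (i.val - 1) by omega, hp _ (by omega)]
    · funext i
      have hi := i.isLt
      simp only [u']
      split_ifs with h h' h' <;> try omega
      · simp [u, show n - (n - i.val) = 0 by omega]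
      · simp only [u]
        rw [show n + 1 - (n + 1 - 1 - i.val + 1) = i - 1 + 1 by omega,
          show n + 1 - (n + 1 - i.val + 1) = i - 1 by omega, Finset.sum_range_succ]
        ring
  rw [← h1, ← h2, ← baseSwap_neg hM hS hn u' hu', ← baseSwap_rotate hM hS u' hu']
  refine baseSwap_congr M fun i hi => ?_
  rcases i with _ | i
  · simp [u']
  · have : i ≠ n + 1 := by omega
    simp [u', this]

theorem sum_swapM_cyclic {M : Mould Γ} (hM : IsAlternal M) (hS : IsAlternal (swapM M))
    {n : ℕ} (hn : 1 ≤ n) (σ : Fin (n + 1) → Γ) (v : Fin (n + 1) → ℚ) :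
    ∑ i ∈ Finset.range (n + 1),
      swapM M (n + 1) (fun j => extG σ ((i + j.val) % (n + 1)))
        (fun j => extQ v ((i + j.val) % (n + 1))) = 0 := by
  let w : ℕ → Γ × ℚ := fun i => (extG σ (i % (n + 1)), extQ v (i % (n + 1)))
  let t : Γ × ℚ := ((∏ i ∈ Finset.range (n + 1), (w i).1)⁻¹, 0)
  have hc : IsCyclicWord (n + 1) t w := ⟨fun i => by simp [w], by simp [t]⟩
  have hck : ∀ k, IsCyclicWord (n + 1) t (fun i => w (i + k)) := by
    intro k
    induction k with
    | zero => exact hc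
    | succ k ih => simpa only [Nat.add_assoc, Nat.add_comm 1 k] using ih.shift
  rw [← sum_baseSwap_insSeq hS hn t w]
  refine Finset.sum_congr rfl fun k hk => ?_
  have hk := Finset.mem_range.1 hk
  have e : (fun i => w (i + (n + 1) + k)) = fun i => w (i + k) := by
    funext i
    rw [Nat.add_right_comm, hc.1]
  rw [baseSwap_insSeq hM hS hn hc hk.le, ← e, ← baseSwap_insSeq hM hS hn (hck k) le_rfl,
    ← swapM_eq_baseSwap]
  congr 1 <;> funext i <;> simp only [insSeq, i.isLt, if_true, w, t, Nat.add_comm k]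
  simp

/-- Theorem (embedding): a bialternal mould in `ARI(Γ)` with vanishing
depth-1 component is push-invariant and has pus-neutral swap, i.e. it lies
in `ARI(Γ)_{push/pusnu}`. -/
theorem bialternal_mem_push_pusnu (Γ : Type) [CommGroup Γ] [Fintype Γ]
    (M : Mould Γ) (hM : IsARI M) (hbal : IsBialternal M)
    (h1 : ∀ σ x, M 1 σ x = 0) :
    pushM M = M ∧ IsPusNeutral (swapM M) := by
  obtain ⟨hA, hS, -⟩ := hbal
  refine ⟨?_, fun m hm σ v => ?_⟩
  · funext m σ x
    match m with
    | 0 => exact (hM _ _).trans (hM _ _).symm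
    | 1 => exact (h1 _ _).trans (h1 _ _).symm
    | n + 2 => exact pushM_eq_of_bialternal hA hS (by omega) σ x
  · match m, hm with
    | 1, _ => exact Finset.sum_eq_zero fun i _ => h1 _ _
    | n + 2, _ => exact sum_swapM_cyclic hA hS (by omega) σ v

end KVMould
end
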